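/- Fix an integer d ≥ 1 and a real s ≥ d. Let A ⊆ ℝ^d be a bounded set that is almost clopen, i.e., its topological boundary ∂A satisfies H_d(∂A) = 0, and let g_{s,d}(U^d) ∈ (0,∞) denote the limit lim_{N→∞} ℰ_s(U^d,N)/τ_{s,d}(N) for the unit cube U^d = [0,1]^d. Then lim_{N→∞} ℰ_s(A,N)/τ_{s,d}(N) exists in [0,∞] and equals g_{s,d}(U^d) · H_d(A)^{−s/d} (in particular the limit is +∞ when H_d(A) = 0). -/

import Mathlib

open scoped ENNReal NNReal BigOperators Classical
open MeasureTheory Filter Metric Set Topology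

/-- The Riesz `s`-energy of a finite configuration `ω`, valued in `[0,∞]`. -/
noncomputable def rieszEnergy {E : Type*} [PseudoEMetricSpace E] (s : ℝ) (ω : Finset E) : ℝ≥0∞ :=
  ∑ x ∈ ω, ∑ y ∈ ω, if x = y then 0 else edist x y ^ (-s)

/-- The `N`-point minimal Riesz `s`-energy over a set `A` (infimum over all `N`-point
subsets of `A`; `∞` if there is none). -/
noncomputable def minRieszEnergy {E : Type*} [PseudoEMetricSpace E] (s : ℝ) (A : Set E)
    (N : ℕ) : ℝ≥0∞ :=
  ⨅ (ω : Finset E) (_ : ↑ω ⊆ A) (_ : ω.card = N), rieszEnergy s ω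

/-- The normalizing sequence `τ_{s,d}(N)`: `N^{1+s/d}` for `s > d` and `N² log N` for `s = d`. -/
noncomputable def tauNorm (s : ℝ) (d : ℕ) (N : ℕ) : ℝ :=
  if s = (d : ℝ) then (N : ℝ) ^ 2 * Real.log N else (N : ℝ) ^ (1 + s / (d : ℝ))

/-- The unit cube `[0,1]^d` in `ℝ^d`. -/
def unitCube (d : ℕ) : Set (EuclideanSpace ℝ (Fin d)) := {x | ∀ i, x i ∈ Set.Icc (0 : ℝ) 1}


section Energy

variable {E : Type*} [PseudoEMetricSpace E] {s : ℝ}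

lemma ENNReal.rpow_neg_anti (hs : 0 ≤ s) {x y : ℝ≥0∞} (h : x ≤ y) : y ^ (-s) ≤ x ^ (-s) := by
  rw [ENNReal.rpow_neg, ENNReal.rpow_neg]
  exact ENNReal.inv_le_inv.2 (ENNReal.rpow_le_rpow h hs)

lemma rieszEnergy_mono {ω ω' : Finset E} (h : ω ⊆ ω') : rieszEnergy s ω ≤ rieszEnergy s ω' :=
  (Finset.sum_le_sum fun _ _ => Finset.sum_le_sum_of_subset h).trans
    (Finset.sum_le_sum_of_subset h)

lemma minRieszEnergy_le_of_le_card {A : Set E} {N : ℕ} {ω : Finset E} (hω : ↑ω ⊆ A)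
    (hN : N ≤ ω.card) : minRieszEnergy s A N ≤ rieszEnergy s ω := by
  obtain ⟨t, ht, htN⟩ := Finset.exists_subset_card_eq hN
  have htA : (t : Set E) ⊆ A := (Finset.coe_subset.2 ht).trans hω
  exact (iInf_le_of_le t (iInf_le_of_le htA (iInf_le_of_le htN le_rfl))).trans
    (rieszEnergy_mono ht)

lemma minRieszEnergy_le {A : Set E} {ω : Finset E} (hω : ↑ω ⊆ A) :
    minRieszEnergy s A ω.card ≤ rieszEnergy s ω :=
  minRieszEnergy_le_of_le_card hω le_rfl

lemma le_minRieszEnergy {A : Set E} {N : ℕ} {c : ℝ≥0∞}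
    (h : ∀ ω : Finset E, ↑ω ⊆ A → ω.card = N → c ≤ rieszEnergy s ω) :
    c ≤ minRieszEnergy s A N :=
  le_iInf fun ω => le_iInf fun h₁ => le_iInf fun h₂ => h ω h₁ h₂

lemma rieszEnergy_image {E' : Type*} [PseudoEMetricSpace E'] [DecidableEq E'] {c : ℝ≥0∞} (hc₀ : c ≠ 0)
    (hc : c ≠ ∞) (f : E → E') (hf : Function.Injective f)
    (hd : ∀ x y, edist (f x) (f y) = c * edist x y) (ω : Finset E) :
    rieszEnergy s (ω.image f) = c ^ (-s) * rieszEnergy s ω := by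
  unfold rieszEnergy
  rw [Finset.sum_image hf.injOn, Finset.mul_sum]
  refine Finset.sum_congr rfl fun x _ => ?_
  rw [Finset.sum_image hf.injOn, Finset.mul_sum]
  refine Finset.sum_congr rfl fun y _ => ?_
  by_cases hxy : x = y
  · simp [hxy]
  · rw [if_neg (hf.ne hxy), if_neg hxy, hd, ENNReal.rpow_neg, ENNReal.rpow_neg, ENNReal.rpow_neg]
    by_cases hs : 0 ≤ s
    · rw [ENNReal.mul_rpow_of_nonneg _ _ hs, ENNReal.mul_inv]
      · exact Or.inl (by simp [hc₀, hc, ENNReal.rpow_eq_zero_iff])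
      · exact Or.inl (by simp [hc₀, hc, ENNReal.rpow_eq_top_iff])
    · simp only [← ENNReal.rpow_neg]
      exact ENNReal.mul_rpow_of_nonneg _ _ (by linarith)

lemma sum_rieszEnergy_fiber_le {ι : Type*} (F : Finset ι) (ω : Finset E) (idx : E → ι)
    (hidx : ∀ x ∈ ω, idx x ∈ F) :
    ∑ k ∈ F, rieszEnergy s (ω.filter fun x => idx x = k) ≤ rieszEnergy s ω := by
  unfold rieszEnergy
  rw [← Finset.sum_fiberwise_of_maps_to hidx]
  refine Finset.sum_le_sum fun k _ => ?_
  exact Finset.sum_le_sum fun x _ => Finset.sum_le_sum_of_subset (Finset.filter_subset _ _)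

lemma rieszEnergy_biUnion_le {ι : Type*} [DecidableEq E] (hs : 0 ≤ s) (F : Finset ι) (ω : ι → Finset E)
    {δ : ℝ≥0∞} (hdisj : (F : Set ι).PairwiseDisjoint ω)
    (hsep : ∀ i ∈ F, ∀ j ∈ F, i ≠ j → ∀ x ∈ ω i, ∀ y ∈ ω j, δ ≤ edist x y) :
    rieszEnergy s (F.biUnion ω) ≤
      ∑ i ∈ F, rieszEnergy s (ω i) + ((F.biUnion ω).card : ℝ≥0∞) ^ 2 * δ ^ (-s) := by
  have hcard : ((F.biUnion ω).card : ℝ≥0∞) ^ 2 * δ ^ (-s) =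
      ∑ i ∈ F, ∑ x ∈ ω i, ∑ j ∈ F, ∑ y ∈ ω j, δ ^ (-s) := by
    rw [← Finset.sum_biUnion hdisj, ← Finset.sum_biUnion hdisj]
    simp only [Finset.sum_const, nsmul_eq_mul]
    ring
  rw [hcard]
  unfold rieszEnergy
  rw [Finset.sum_biUnion hdisj, ← Finset.sum_add_distrib]
  refine Finset.sum_le_sum fun i hi => ?_
  rw [← Finset.sum_add_distrib]
  refine Finset.sum_le_sum fun x hx => ?_
  rw [Finset.sum_biUnion hdisj, ← Finset.add_sum_erase F _ hi]
  gcongr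
  refine (Finset.sum_le_sum fun j hj => ?_).trans
    (Finset.sum_le_sum_of_subset (Finset.erase_subset i F))
  refine Finset.sum_le_sum fun y hy => ?_
  split_ifs
  · exact zero_le
  · exact ENNReal.rpow_neg_anti hs
      (hsep i hi j (Finset.mem_of_mem_erase hj) (Finset.ne_of_mem_erase hj).symm x hx y hy)

end Energy

section Cube

variable {d : ℕ} {s : ℝ}

/-- The closed axis-parallel cube with lowest corner `a` and side length `t`. -/
def cornerCube (a : EuclideanSpace ℝ (Fin d)) (t : ℝ) : Set (EuclideanSpace ℝ (Fin d)) :=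
  {x | ∀ i, x i ∈ Icc (a i) (a i + t)}

lemma edist_add_smul (a x y : EuclideanSpace ℝ (Fin d)) {t : ℝ} (ht : 0 < t) :
    edist (a + t • x) (a + t • y) = ENNReal.ofReal t * edist x y := by
  rw [edist_add_left, edist_smul₀, ENNReal.smul_def, smul_eq_mul, ENNReal.ofReal,
    Real.nnnorm_of_nonneg ht.le, Real.toNNReal_of_nonneg ht.le]

lemma add_smul_injective (a : EuclideanSpace ℝ (Fin d)) {t : ℝ} (ht : 0 < t) :
    Function.Injective fun x : EuclideanSpace ℝ (Fin d) => a + t • x :=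
  (add_right_injective a).comp (smul_right_injective _ ht.ne')

lemma rieszEnergy_image_add_smul (a : EuclideanSpace ℝ (Fin d)) {t : ℝ} (ht : 0 < t)
    (ω : Finset (EuclideanSpace ℝ (Fin d))) :
    rieszEnergy s (ω.image fun x => a + t • x) =
      ENNReal.ofReal t ^ (-s) * rieszEnergy s ω :=
  rieszEnergy_image (by simpa using ht) ENNReal.ofReal_ne_top _ (add_smul_injective a ht)
    (fun x y => edist_add_smul a x y ht) ω

lemma add_smul_mem_cornerCube (a : EuclideanSpace ℝ (Fin d)) {t : ℝ} (ht : 0 < t)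
    {x : EuclideanSpace ℝ (Fin d)} (hx : x ∈ unitCube d) : a + t • x ∈ cornerCube a t := by
  intro i
  obtain ⟨h₀, h₁⟩ := hx i
  simp only [PiLp.add_apply, PiLp.smul_apply, smul_eq_mul]
  constructor <;> nlinarith

lemma le_rieszEnergy_of_subset_cornerCube (a : EuclideanSpace ℝ (Fin d)) {t : ℝ} (ht : 0 < t)
    {ω : Finset (EuclideanSpace ℝ (Fin d))} (hω : ↑ω ⊆ cornerCube a t) :
    ENNReal.ofReal t ^ (-s) * minRieszEnergy s (unitCube d) ω.card ≤ rieszEnergy s ω := by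
  set b : EuclideanSpace ℝ (Fin d) := -(t⁻¹ • a)
  have hinv : ω = (ω.image fun x => b + t⁻¹ • x).image fun x => a + t • x := by
    rw [Finset.image_image]
    conv_lhs => rw [← Finset.image_id (s := ω)]
    congr 1
    funext x
    simp [b, smul_smul, ht.ne']
  have hcard : (ω.image fun x => b + t⁻¹ • x).card = ω.card :=
    Finset.card_image_of_injective _ (add_smul_injective b (inv_pos.2 ht))
  conv_rhs => rw [hinv, rieszEnergy_image_add_smul a ht]
  rw [← hcard]
  gcongr
  apply minRieszEnergy_le
  intro x hx
  obtain ⟨y, hy, rfl⟩ := Finset.mem_image.1 (Finset.mem_coe.1 hx)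
  intro i
  obtain ⟨h₀, h₁⟩ := hω hy i
  simp only [b, PiLp.add_apply, PiLp.neg_apply, PiLp.smul_apply, smul_eq_mul]
  rw [← sub_eq_neg_add, ← mul_sub, inv_mul_eq_div]
  constructor
  · exact div_nonneg (by linarith) ht.le
  · rw [div_le_one ht]; linarith

lemma le_rieszEnergy_of_cover {ι : Type*} (F : Finset ι) (a : ι → EuclideanSpace ℝ (Fin d))
    {t : ℝ} (ht : 0 < t) {ω : Finset (EuclideanSpace ℝ (Fin d))}
    (hω : ∀ x ∈ ω, ∃ k ∈ F, x ∈ cornerCube (a k) t) :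
    ∃ n : ι → ℕ, ∑ k ∈ F, n k = ω.card ∧
      ENNReal.ofReal t ^ (-s) * ∑ k ∈ F, minRieszEnergy s (unitCube d) (n k) ≤
        rieszEnergy s ω := by
  rcases F.eq_empty_or_nonempty with rfl | ⟨k₀, _⟩
  · refine ⟨fun _ => 0, ?_, by simp⟩
    rw [Finset.sum_empty, eq_comm, Finset.card_eq_zero, Finset.eq_empty_iff_forall_notMem]
    intro x hx
    simpa using hω x hx
  have : Nonempty ι := ⟨k₀⟩
  choose! idx hidx hcube using hω
  refine ⟨fun k => (ω.filter fun x => idx x = k).card,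
    (Finset.card_eq_sum_card_fiberwise hidx).symm, ?_⟩
  rw [Finset.mul_sum]
  refine le_trans (Finset.sum_le_sum fun k _ => ?_) (sum_rieszEnergy_fiber_le F ω idx hidx)
  apply le_rieszEnergy_of_subset_cornerCube (a k) ht
  intro x hx
  obtain ⟨hxω, rfl⟩ := Finset.mem_filter.1 (Finset.mem_coe.1 hx)
  exact hcube x hxω

lemma minRieszEnergy_le_of_separated_cubes {ι : Type*} (hs : 0 ≤ s)
    {A : Set (EuclideanSpace ℝ (Fin d))} (F : Finset ι) (hF : F.Nonempty)
    (a : ι → EuclideanSpace ℝ (Fin d)) {t δ : ℝ} (ht : 0 < t) (hδ : 0 < δ)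
    (hA : ∀ k ∈ F, cornerCube (a k) t ⊆ A)
    (hsep : ∀ i ∈ F, ∀ j ∈ F, i ≠ j → ∀ x ∈ cornerCube (a i) t, ∀ y ∈ cornerCube (a j) t,
      δ ≤ dist x y) {N n : ℕ} (hN : N ≤ F.card * n) :
    minRieszEnergy s A N ≤
      F.card * ENNReal.ofReal t ^ (-s) * minRieszEnergy s (unitCube d) n +
        ((F.card * n : ℕ) : ℝ≥0∞) ^ 2 * ENNReal.ofReal δ ^ (-s) := by
  have htop : ENNReal.ofReal t ^ (-s) ≠ ∞ := by
    simp [ENNReal.rpow_eq_top_iff, ht, not_lt.2 hs]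
  have hne : ENNReal.ofReal t ^ (-s) ≠ 0 := by
    simp [ENNReal.rpow_eq_zero_iff, not_lt.2 hs]
  have hc₀ : (F.card : ℝ≥0∞) * ENNReal.ofReal t ^ (-s) ≠ 0 :=
    mul_ne_zero (by simpa using hF.ne_empty) hne
  have hc : (F.card : ℝ≥0∞) * ENNReal.ofReal t ^ (-s) ≠ ∞ :=
    ENNReal.mul_ne_top (ENNReal.natCast_ne_top _) htop
  rw [← tsub_le_iff_right, mul_comm _ (minRieszEnergy s (unitCube d) n),
    ← ENNReal.div_le_iff_le_mul (Or.inl hc₀) (Or.inl hc)]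
  refine le_minRieszEnergy fun ω hω hωn => ?_
  rw [ENNReal.div_le_iff_le_mul (Or.inl hc₀) (Or.inl hc), tsub_le_iff_right]
  have hmem : ∀ k, ∀ x ∈ ω.image (fun x => a k + t • x), x ∈ cornerCube (a k) t := by
    intro k x hx
    obtain ⟨y, hy, rfl⟩ := Finset.mem_image.1 hx
    exact add_smul_mem_cornerCube _ ht (hω hy)
  have hdisj : (F : Set ι).PairwiseDisjoint fun k => ω.image fun x => a k + t • x := by
    intro i hi j hj hij
    refine Finset.disjoint_left.2 fun x hx hx' => ?_
    have := hsep i hi j hj hij x (hmem i x hx) x (hmem j x hx')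
    rw [dist_self] at this
    linarith
  have hcard : (F.biUnion fun k => ω.image fun x => a k + t • x).card = F.card * n := by
    rw [Finset.card_biUnion hdisj]
    simp [Finset.card_image_of_injective _ (add_smul_injective _ ht), hωn]
  refine (minRieszEnergy_le_of_le_card (ω := F.biUnion fun k => ω.image fun x => a k + t • x)
    ?_ (hcard ▸ hN)).trans ?_
  · intro x hx
    obtain ⟨k, hk, hx⟩ := Finset.mem_biUnion.1 (Finset.mem_coe.1 hx)
    exact hA k hk (hmem k x hx)
  · refine (rieszEnergy_biUnion_le hs F _ (δ := ENNReal.ofReal δ) hdisj ?_).trans ?_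
    · intro i hi j hj hij x hx y hy
      rw [edist_dist]
      exact ENNReal.ofReal_le_ofReal (hsep i hi j hj hij x (hmem i x hx) y (hmem j y hy))
    · rw [hcard]
      gcongr
      simp only [rieszEnergy_image_add_smul _ ht, Finset.sum_const, nsmul_eq_mul]
      exact le_of_eq (by ring)

end Cube

section Normalization

variable {s : ℝ} {d : ℕ}

/-- The slowly varying factor of `tauNorm s d`: `log N` if `s = d`, and `1` otherwise. -/
noncomputable def tauLogFactor (s : ℝ) (d N : ℕ) : ℝ :=
  if s = (d : ℝ) then Real.log N else 1

lemma tauNorm_eq (hd : 1 ≤ d) (N : ℕ) :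
    tauNorm s d N = (N : ℝ) ^ (1 + s / (d : ℝ)) * tauLogFactor s d N := by
  unfold tauNorm tauLogFactor
  split_ifs with h
  · have hd0 : (d : ℝ) ≠ 0 := by positivity
    rw [h, div_self hd0, one_add_one_eq_two, Real.rpow_two]
  · rw [mul_one]

lemma tauLogFactor_mono : Monotone (tauLogFactor s d) := by
  intro m n h
  unfold tauLogFactor
  split_ifs
  · rcases m.eq_zero_or_pos with rfl | hm
    · simpa using Real.log_natCast_nonneg n
    · exact Real.log_le_log (by exact_mod_cast hm) (by exact_mod_cast h)
  · exact le_rfl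

lemma tauLogFactor_pos {N : ℕ} (hN : 2 ≤ N) : 0 < tauLogFactor s d N := by
  unfold tauLogFactor
  split_ifs
  · exact Real.log_pos (by exact_mod_cast hN)
  · exact zero_lt_one

lemma tauNorm_pos (hd : 1 ≤ d) {N : ℕ} (hN : 2 ≤ N) : 0 < tauNorm s d N := by
  rw [tauNorm_eq hd]
  have := tauLogFactor_pos (s := s) (d := d) hN
  positivity

lemma tendsto_ceil_mul_natCast_div {a : ℝ} (ha : 0 < a) :
    Tendsto (fun N : ℕ => (⌈a * N⌉₊ : ℝ) / N) atTop (𝓝 a) :=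
  (tendsto_nat_ceil_mul_div_atTop ha.le).comp tendsto_natCast_atTop_atTop

lemma tendsto_ceil_mul_natCast {a : ℝ} (ha : 0 < a) :
    Tendsto (fun N : ℕ => ⌈a * N⌉₊) atTop atTop :=
  tendsto_nat_ceil_atTop.comp (tendsto_natCast_atTop_atTop.const_mul_atTop ha)

lemma tendsto_tauLogFactor_ceil_div {a : ℝ} (ha : 0 < a) :
    Tendsto (fun N : ℕ => tauLogFactor s d ⌈a * N⌉₊ / tauLogFactor s d N) atTop (𝓝 1) := by
  unfold tauLogFactor
  split_ifs
  · have hlog : Tendsto (fun N : ℕ => Real.log N) atTop atTop :=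
      Real.tendsto_log_atTop.comp tendsto_natCast_atTop_atTop
    have h := (((tendsto_ceil_mul_natCast_div ha).log ha.ne').div_atTop hlog).add_const 1
    rw [zero_add] at h
    refine h.congr' ?_
    filter_upwards [eventually_ge_atTop 2] with N hN
    have hN0 : (0 : ℝ) < N := by positivity
    have hl : 0 < Real.log N := Real.log_pos (by exact_mod_cast hN)
    have hc : (0 : ℝ) < ⌈a * N⌉₊ := by exact_mod_cast Nat.ceil_pos.2 (by positivity)
    rw [Real.log_div hc.ne' hN0.ne']
    field_simp
    ring
  · simp

lemma tendsto_tauNorm_ceil_div (hd : 1 ≤ d) {a : ℝ} (ha : 0 < a) :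
    Tendsto (fun N : ℕ => tauNorm s d ⌈a * N⌉₊ / tauNorm s d N) atTop
      (𝓝 (a ^ (1 + s / (d : ℝ)))) := by
  have h := ((tendsto_ceil_mul_natCast_div ha).rpow_const (p := 1 + s / (d : ℝ))
    (Or.inl ha.ne')).mul (tendsto_tauLogFactor_ceil_div (s := s) (d := d) ha)
  rw [mul_one] at h
  refine h.congr fun N => ?_
  rw [tauNorm_eq hd, tauNorm_eq hd, Real.div_rpow (by positivity) (by positivity), div_mul_div_comm]

lemma tendsto_sq_div_tauNorm (hd : 1 ≤ d) (hs : (d : ℝ) ≤ s) :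
    Tendsto (fun N : ℕ => (N : ℝ) ^ 2 / tauNorm s d N) atTop (𝓝 0) := by
  have hd0 : (0 : ℝ) < d := by positivity
  unfold tauNorm
  split_ifs with h
  · have hlog : Tendsto (fun N : ℕ => Real.log N) atTop atTop :=
      Real.tendsto_log_atTop.comp tendsto_natCast_atTop_atTop
    refine hlog.inv_tendsto_atTop.congr' ?_
    filter_upwards [eventually_ge_atTop 1] with N hN
    have hN0 : (0 : ℝ) < N := by positivity
    rw [← div_div, div_self (by positivity), one_div, Pi.inv_apply]
  · have hexp : 0 < s / d - 1 := by
      rw [sub_pos, one_lt_div hd0]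
      exact lt_of_le_of_ne hs (Ne.symm h)
    refine ((tendsto_rpow_neg_atTop hexp).comp tendsto_natCast_atTop_atTop).congr' ?_
    filter_upwards [eventually_ge_atTop 1] with N hN
    have hN0 : (0 : ℝ) < N := by positivity
    rw [Function.comp_apply, ← Real.rpow_two, ← Real.rpow_sub hN0]
    congr 1
    ring

lemma tendsto_ceil_mul_natCast_sq_div_tauNorm (hd : 1 ≤ d) (hs : (d : ℝ) ≤ s) {a : ℝ}
    (ha : 0 < a) :
    Tendsto (fun N : ℕ => (⌈a * N⌉₊ : ℝ) ^ 2 / tauNorm s d N) atTop (𝓝 0) := by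
  have h := ((tendsto_ceil_mul_natCast_div ha).pow 2).mul (tendsto_sq_div_tauNorm hd hs)
  rw [mul_zero] at h
  refine h.congr' ?_
  filter_upwards [eventually_ge_atTop 1] with N hN
  have hN0 : (0 : ℝ) < N := by positivity
  field_simp

lemma eventually_forall_le_of_tendsto_div_tauNorm (hd : 1 ≤ d) (hs : 0 ≤ s) {e : ℕ → ℝ≥0∞}
    {g : ℝ} (hg : 0 < g)
    (hlim : Tendsto (fun N : ℕ => e N / ENNReal.ofReal (tauNorm s d N)) atTop
      (𝓝 (ENNReal.ofReal g))) {δ : ℝ} (hδ : 0 < δ) (hδ1 : δ < 1) :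
    ∀ᶠ N : ℕ in atTop, ∀ n : ℕ, ENNReal.ofReal (g * (1 - δ) ^ 2 *
      (((n : ℝ) / N) ^ (1 + s / (d : ℝ)) - δ ^ (1 + s / (d : ℝ))) * tauNorm s d N) ≤ e n := by
  set p : ℝ := 1 + s / (d : ℝ) with hp_def
  have hp : 0 < p := by positivity
  have h1δ : 0 < 1 - δ := by linarith
  have hlt : ENNReal.ofReal (g * (1 - δ)) < ENNReal.ofReal g :=
    (ENNReal.ofReal_lt_ofReal_iff hg).2 (by nlinarith)
  have hlow : ∀ᶠ n : ℕ in atTop, ENNReal.ofReal (g * (1 - δ) * tauNorm s d n) ≤ e n := by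
    filter_upwards [hlim.eventually (lt_mem_nhds hlt), eventually_ge_atTop 2] with n hn hn2
    have hτ := tauNorm_pos (s := s) hd hn2
    rw [ENNReal.ofReal_mul (by positivity)]
    exact ENNReal.mul_le_of_le_div hn.le
  obtain ⟨n₀, hn₀⟩ := eventually_atTop.1 hlow
  have hratio : ∀ᶠ N : ℕ in atTop, 1 - δ < tauLogFactor s d ⌈δ * N⌉₊ / tauLogFactor s d N :=
    (tendsto_tauLogFactor_ceil_div hδ).eventually (lt_mem_nhds (by linarith))
  filter_upwards [hratio, (tendsto_ceil_mul_natCast hδ).eventually_ge_atTop n₀,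
    eventually_ge_atTop 2] with N hN hNn₀ hN2 n
  have hN0 : (0 : ℝ) < N := by positivity
  have hℓ := tauLogFactor_pos (s := s) (d := d) hN2
  rcases le_total (n : ℝ) (δ * N) with hn | hn
  · rw [ENNReal.ofReal_of_nonpos]
    · exact zero_le
    · refine mul_nonpos_of_nonpos_of_nonneg (mul_nonpos_of_nonneg_of_nonpos (by positivity) ?_)
        (tauNorm_pos hd hN2).le
      rw [sub_nonpos]
      exact Real.rpow_le_rpow (by positivity) ((div_le_iff₀ hN0).2 hn) hp.le
  · have hceil : ⌈δ * N⌉₊ ≤ n := Nat.ceil_le.2 hn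
    refine le_trans (ENNReal.ofReal_le_ofReal ?_) (hn₀ n (hNn₀.trans hceil))
    have hℓn : (1 - δ) * tauLogFactor s d N ≤ tauLogFactor s d n :=
      ((lt_div_iff₀ hℓ).1 hN).le.trans (tauLogFactor_mono hceil)
    have hδp : 0 ≤ δ ^ p := by positivity
    rw [tauNorm_eq hd, tauNorm_eq hd, ← hp_def]
    calc g * (1 - δ) ^ 2 * (((n : ℝ) / N) ^ p - δ ^ p) * ((N : ℝ) ^ p * tauLogFactor s d N)
        ≤ g * (1 - δ) ^ 2 * ((n : ℝ) / N) ^ p * ((N : ℝ) ^ p * tauLogFactor s d N) := by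
          gcongr; linarith
      _ = g * (1 - δ) * ((n : ℝ) ^ p * ((1 - δ) * tauLogFactor s d N)) := by
          rw [Real.div_rpow (by positivity) (by positivity)]
          field_simp
      _ ≤ _ := by gcongr

end Normalization

section Asymptotics

variable {s : ℝ} {d : ℕ} {A : Set (EuclideanSpace ℝ (Fin d))} {g t : ℝ} {ι : Type*} {F : Finset ι}
  {a : ι → EuclideanSpace ℝ (Fin d)}

lemma scaled_cube_constant_eq (hd : 1 ≤ d) (hg : 0 < g) (ht : 0 < t) {M : ℕ} (hM : 0 < M) :
    ENNReal.ofReal t ^ (-s) * ENNReal.ofReal (g * (M : ℝ) ^ (-(s / (d : ℝ)))) =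
      ENNReal.ofReal g * ENNReal.ofReal (M * t ^ d) ^ (-(s / (d : ℝ))) := by
  have hd0 : (d : ℝ) ≠ 0 := by positivity
  rw [ENNReal.ofReal_rpow_of_pos ht, ENNReal.ofReal_rpow_of_pos (by positivity),
    ← ENNReal.ofReal_mul (by positivity), ← ENNReal.ofReal_mul hg.le,
    Real.mul_rpow (by positivity) (by positivity), ← Real.rpow_natCast t d, ← Real.rpow_mul ht.le]
  congr 1
  rw [show (d : ℝ) * -(s / d) = -s by field_simp]
  ring

lemma rpow_one_sub_le_sum_rpow (hF : F.Nonempty) {p : ℝ} (hp : 1 ≤ p) {x : ι → ℝ}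
    (hx : ∀ k ∈ F, 0 ≤ x k) (hsum : ∑ k ∈ F, x k = 1) :
    (F.card : ℝ) ^ (1 - p) ≤ ∑ k ∈ F, x k ^ p := by
  have h := Real.rpow_sum_le_const_mul_sum_rpow F x hp
  have habs : ∀ k ∈ F, |x k| = x k := fun k hk => abs_of_nonneg (hx k hk)
  rw [Finset.sum_congr rfl habs, Finset.sum_congr rfl fun k hk => congrArg (· ^ p) (habs k hk),
    hsum, Real.one_rpow] at h
  have hM : (0 : ℝ) < F.card := by exact_mod_cast hF.card_pos
  rw [← neg_sub, Real.rpow_neg hM.le]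
  exact (inv_le_iff_one_le_mul₀' (by positivity)).2 h

lemma le_liminf_of_subset_iUnion_cornerCube (hd : 1 ≤ d) (hs : 0 ≤ s) (hg : 0 < g)
    (hlim : Tendsto
      (fun N : ℕ => minRieszEnergy s (unitCube d) N / ENNReal.ofReal (tauNorm s d N)) atTop
      (𝓝 (ENNReal.ofReal g))) (hF : F.Nonempty) (ht : 0 < t)
    (hA : ∀ x ∈ A, ∃ k ∈ F, x ∈ cornerCube (a k) t) :
    ENNReal.ofReal g * ENNReal.ofReal (F.card * t ^ d) ^ (-(s / (d : ℝ))) ≤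
      liminf (fun N : ℕ => minRieszEnergy s A N / ENNReal.ofReal (tauNorm s d N)) atTop := by
  set p : ℝ := 1 + s / (d : ℝ) with hp_def
  have hp : 1 ≤ p := le_add_of_nonneg_right (by positivity)
  have hδ : ∀ δ ∈ Ioo (0 : ℝ) 1, ENNReal.ofReal t ^ (-s) * ENNReal.ofReal
      (g * (1 - δ) ^ 2 * ((F.card : ℝ) ^ (1 - p) - F.card * δ ^ p)) ≤
      liminf (fun N : ℕ => minRieszEnergy s A N / ENNReal.ofReal (tauNorm s d N)) atTop := by
    rintro δ ⟨hδ0, hδ1⟩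
    refine le_liminf_of_le (by isBoundedDefault) ?_
    filter_upwards [eventually_forall_le_of_tendsto_div_tauNorm hd hs hg hlim hδ0 hδ1,
      eventually_ge_atTop 2] with N hN hN2
    have hτ := tauNorm_pos (s := s) hd hN2
    have hN0 : (0 : ℝ) < N := by positivity
    rw [ENNReal.le_div_iff_mul_le (Or.inl (by simpa using hτ)) (Or.inl ENNReal.ofReal_ne_top)]
    refine le_minRieszEnergy fun ω hω hcard => ?_
    obtain ⟨n, hn, hle⟩ := le_rieszEnergy_of_cover (s := s) F a ht fun x hx => hA x (hω hx)
    refine le_trans ?_ hle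
    rw [mul_assoc, ← ENNReal.ofReal_mul' hτ.le]
    gcongr
    refine le_trans ?_ (Finset.sum_le_sum fun k _ => hN (n k))
    refine le_trans ?_ (Finset.le_sum_of_subadditive ENNReal.ofReal (by simp)
      (fun _ _ => ENNReal.ofReal_add_le) F _)
    apply ENNReal.ofReal_le_ofReal
    rw [← Finset.sum_mul, ← Finset.mul_sum, Finset.sum_sub_distrib, Finset.sum_const, nsmul_eq_mul]
    gcongr
    refine rpow_one_sub_le_sum_rpow hF hp (fun k _ => by positivity) ?_
    rw [← Finset.sum_div, div_eq_one_iff_eq hN0.ne', ← Nat.cast_sum, hn, hcard]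
  have hcont : Tendsto (fun δ : ℝ => ENNReal.ofReal t ^ (-s) * ENNReal.ofReal
      (g * (1 - δ) ^ 2 * ((F.card : ℝ) ^ (1 - p) - F.card * δ ^ p))) (𝓝[>] 0)
      (𝓝 (ENNReal.ofReal t ^ (-s) * ENNReal.ofReal (g * (F.card : ℝ) ^ (-(s / (d : ℝ)))))) := by
    refine ENNReal.Tendsto.const_mul (ENNReal.tendsto_ofReal ?_)
      (Or.inr (by simp [ENNReal.rpow_eq_top_iff, ht, not_lt.2 hs]))
    have : ContinuousAt (fun δ : ℝ =>
        g * (1 - δ) ^ 2 * ((F.card : ℝ) ^ (1 - p) - F.card * δ ^ p)) 0 := by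
      have := Real.continuousAt_rpow_const 0 p (Or.inr (by linarith))
      fun_prop
    have h := this.tendsto.mono_left (nhdsWithin_le_nhds (s := Ioi 0))
    rw [Real.zero_rpow (by linarith)] at h
    simpa [hp_def] using h
  rw [← scaled_cube_constant_eq hd hg ht hF.card_pos]
  refine le_of_tendsto hcont ?_
  filter_upwards [Ioo_mem_nhdsGT (zero_lt_one' ℝ)] with δ h using hδ δ h

lemma limsup_le_of_separated_cubes (hd : 1 ≤ d) (hs : (d : ℝ) ≤ s) (hg : 0 < g)
    (hlim : Tendsto
      (fun N : ℕ => minRieszEnergy s (unitCube d) N / ENNReal.ofReal (tauNorm s d N)) atTop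
      (𝓝 (ENNReal.ofReal g))) (hF : F.Nonempty) (ht : 0 < t) {δ : ℝ} (hδ : 0 < δ)
    (hA : ∀ k ∈ F, cornerCube (a k) t ⊆ A)
    (hsep : ∀ i ∈ F, ∀ j ∈ F, i ≠ j → ∀ x ∈ cornerCube (a i) t, ∀ y ∈ cornerCube (a j) t,
      δ ≤ dist x y) :
    limsup (fun N : ℕ => minRieszEnergy s A N / ENNReal.ofReal (tauNorm s d N)) atTop ≤
      ENNReal.ofReal g * ENNReal.ofReal (F.card * t ^ d) ^ (-(s / (d : ℝ))) := by
  have hs0 : 0 ≤ s := (Nat.cast_nonneg d).trans hs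
  have hM : (0 : ℝ) < F.card := by exact_mod_cast hF.card_pos
  have hM' : (0 : ℝ) < (F.card : ℝ)⁻¹ := inv_pos.2 hM
  set m : ℕ → ℕ := fun N => ⌈(F.card : ℝ)⁻¹ * N⌉₊ with hm
  have htop : ∀ {r : ℝ}, 0 < r → ENNReal.ofReal r ^ (-s) ≠ ∞ := fun hr => by
    simp [ENNReal.rpow_eq_top_iff, hr, not_lt.2 hs0]
  have hmain := ENNReal.Tendsto.const_mul (a := F.card * ENNReal.ofReal t ^ (-s))
    (ENNReal.Tendsto.mul (hlim.comp (tendsto_ceil_mul_natCast hM')) (Or.inr ENNReal.ofReal_ne_top)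
      (ENNReal.tendsto_ofReal (tendsto_tauNorm_ceil_div (s := s) hd hM'))
      (Or.inr ENNReal.ofReal_ne_top))
    (Or.inr (ENNReal.mul_ne_top (ENNReal.natCast_ne_top _) (htop ht)))
  have hcross := ENNReal.Tendsto.mul_const (b := ENNReal.ofReal δ ^ (-s))
    (ENNReal.tendsto_ofReal
      ((tendsto_ceil_mul_natCast_sq_div_tauNorm hd hs hM').const_mul ((F.card : ℝ) ^ 2)))
    (Or.inr (htop hδ))
  have hsum := hmain.add hcross
  have hconst : F.card * ENNReal.ofReal t ^ (-s) *
        (ENNReal.ofReal g * ENNReal.ofReal ((F.card : ℝ)⁻¹ ^ (1 + s / (d : ℝ)))) +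
        ENNReal.ofReal ((F.card : ℝ) ^ 2 * 0) * ENNReal.ofReal δ ^ (-s) =
      ENNReal.ofReal g * ENNReal.ofReal (F.card * t ^ d) ^ (-(s / (d : ℝ))) := by
    rw [← scaled_cube_constant_eq hd hg ht hF.card_pos, mul_zero, ENNReal.ofReal_zero, zero_mul,
      add_zero, mul_comm (F.card : ℝ≥0∞), mul_assoc, ← ENNReal.ofReal_mul hg.le,
      ← ENNReal.ofReal_natCast, ← ENNReal.ofReal_mul hM.le]
    congr 2
    rw [Real.inv_rpow hM.le, Real.rpow_add hM, Real.rpow_one, Real.rpow_neg hM.le]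
    field_simp
  rw [hconst] at hsum
  rw [← hsum.limsup_eq]
  refine limsup_le_limsup ?_
  filter_upwards [(tendsto_ceil_mul_natCast hM').eventually_ge_atTop 2,
    eventually_ge_atTop 2] with N hm2 hN2
  have hτ := tauNorm_pos (s := s) hd hN2
  have hτm := tauNorm_pos (s := s) hd hm2
  have hNm : N ≤ F.card * m N := by
    have := Nat.le_ceil ((F.card : ℝ)⁻¹ * N)
    rw [inv_mul_le_iff₀ hM] at this
    exact_mod_cast this
  refine (ENNReal.div_le_div_right (minRieszEnergy_le_of_separated_cubes hs0 F hF a ht hδ hA hsep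
    hNm) _).trans (le_of_eq ?_)
  rw [ENNReal.add_div]
  congr 1
  · rw [Function.comp_apply, ENNReal.ofReal_div_of_pos hτ, mul_div_assoc]
    congr 1
    rw [div_eq_mul_inv, div_eq_mul_inv, div_eq_mul_inv, mul_assoc, ← mul_assoc _⁻¹,
      ENNReal.inv_mul_cancel (by simpa using hτm) ENNReal.ofReal_ne_top, one_mul]
  · rw [← mul_div_assoc, ENNReal.ofReal_div_of_pos hτ, ← mul_pow, ← Nat.cast_mul,
      ENNReal.ofReal_pow (by positivity), ENNReal.ofReal_natCast]
    simp only [div_eq_mul_inv]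
    ring

end Asymptotics

section Grid

variable {d : ℕ} {r t : ℝ}

/-- The lowest corner of the cell with index `k` in the cubical grid of mesh `r`. -/
noncomputable def gridCorner (r : ℝ) (k : Fin d → ℤ) : EuclideanSpace ℝ (Fin d) :=
  WithLp.toLp 2 fun i => r * k i

/-- The index of the half-open cell containing `x` in the cubical grid of mesh `r`. -/
noncomputable def gridIndex (r : ℝ) (x : EuclideanSpace ℝ (Fin d)) : Fin d → ℤ :=
  fun i => ⌊x i / r⌋

lemma gridIndex_eq_iff (hr : 0 < r) {x : EuclideanSpace ℝ (Fin d)} {k : Fin d → ℤ} :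
    gridIndex r x = k ↔ ∀ i, x i ∈ Ico (r * k i) (r * k i + r) := by
  simp only [gridIndex, funext_iff, Int.floor_eq_iff, le_div_iff₀ hr, div_lt_iff₀ hr, add_mul,
    one_mul, mem_Ico, mul_comm r]

lemma mem_cornerCube_gridIndex (hr : 0 < r) (x : EuclideanSpace ℝ (Fin d)) :
    x ∈ cornerCube (gridCorner r (gridIndex r x)) r :=
  fun i => Ico_subset_Icc_self ((gridIndex_eq_iff hr).1 rfl i)

lemma volume_gridCell (hr : 0 < r) (k : Fin d → ℤ) :
    volume {x : EuclideanSpace ℝ (Fin d) | gridIndex r x = k} = ENNReal.ofReal (r ^ d) := by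
  have : {x : EuclideanSpace ℝ (Fin d) | gridIndex r x = k} =
      WithLp.ofLp ⁻¹' (univ.pi fun i => Ico (r * k i) (r * k i + r)) := by
    ext x
    simp only [mem_ofPred_eq, gridIndex_eq_iff hr, mem_preimage, mem_univ_pi]
  rw [this, (PiLp.volume_preserving_ofLp (Fin d)).measure_preimage
    (MeasurableSet.univ_pi fun _ => measurableSet_Ico).nullMeasurableSet, Real.volume_pi_Ico]
  simp [ENNReal.ofReal_pow hr.le]

lemma measurableSet_gridCell (hr : 0 < r) (k : Fin d → ℤ) :
    MeasurableSet {x : EuclideanSpace ℝ (Fin d) | gridIndex r x = k} := by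
  simp only [gridIndex_eq_iff hr, ofPred_forall]
  refine MeasurableSet.iInter fun i => ?_
  exact (by fun_prop : Measurable fun x : EuclideanSpace ℝ (Fin d) => x i) measurableSet_Ico

lemma dist_le_of_mem_cornerCube (hr : 0 ≤ r) {a x y : EuclideanSpace ℝ (Fin d)}
    (hx : x ∈ cornerCube a r) (hy : y ∈ cornerCube a r) : dist x y ≤ d * r := by
  rw [EuclideanSpace.dist_eq, Real.sqrt_le_iff]
  refine ⟨by positivity, ?_⟩
  calc ∑ i, dist (x i) (y i) ^ 2 ≤ ∑ _i : Fin d, r ^ 2 := by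
        gcongr with i
        obtain ⟨h₁, h₂⟩ := hx i
        obtain ⟨h₃, h₄⟩ := hy i
        rw [Real.dist_eq, abs_le]
        constructor <;> linarith
    _ = d * r ^ 2 := by simp
    _ ≤ (d : ℝ) ^ 2 * r ^ 2 := by
        gcongr
        exact_mod_cast Nat.le_self_pow two_ne_zero d
    _ = (d * r) ^ 2 := by ring

lemma sub_le_dist_of_mem_cornerCube_gridCorner (hr : 0 ≤ r) {k l : Fin d → ℤ} (hkl : k ≠ l)
    {x y : EuclideanSpace ℝ (Fin d)} (hx : x ∈ cornerCube (gridCorner r k) t)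
    (hy : y ∈ cornerCube (gridCorner r l) t) : r - t ≤ dist x y := by
  obtain ⟨i, hi⟩ := Function.ne_iff.1 hkl
  have hdist : |x i - y i| ≤ dist x y := by
    simpa [dist_eq_norm] using PiLp.norm_apply_le (x - y) i
  refine le_trans ?_ hdist
  obtain ⟨h₁, h₂⟩ := hx i
  obtain ⟨h₃, h₄⟩ := hy i
  simp only [gridCorner] at h₁ h₂ h₃ h₄
  rcases lt_or_gt_of_ne hi with h | h
  · have : (k i : ℝ) + 1 ≤ l i := by exact_mod_cast h
    rw [abs_sub_comm]
    refine le_trans ?_ (le_abs_self _)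
    nlinarith
  · have : (l i : ℝ) + 1 ≤ k i := by exact_mod_cast h
    refine le_trans ?_ (le_abs_self _)
    nlinarith

lemma cornerCube_mono (a : EuclideanSpace ℝ (Fin d)) {t' : ℝ} (h : t ≤ t') :
    cornerCube a t ⊆ cornerCube a t' :=
  fun _ hx i => ⟨(hx i).1, (hx i).2.trans (by linarith)⟩

lemma finite_gridIndex_image (hr : 0 < r) {K : Set (EuclideanSpace ℝ (Fin d))}
    (hK : Bornology.IsBounded K) : (gridIndex r '' K).Finite := by
  obtain ⟨R, hR⟩ := hK.exists_norm_le
  refine (Set.finite_Icc (fun _ : Fin d => ⌊-R / r⌋) fun _ => ⌊R / r⌋).subset ?_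
  rintro _ ⟨x, hx, rfl⟩
  have h : ∀ i, |x i| ≤ R := fun i => (PiLp.norm_apply_le x i).trans (hR x hx)
  refine ⟨fun i => ?_, fun i => ?_⟩ <;> refine Int.floor_le_floor ?_ <;> gcongr
  · exact (abs_le.1 (h i)).1
  · exact (abs_le.1 (h i)).2

lemma cornerCube_gridIndex_subset_cthickening (hr : 0 < r) {K : Set (EuclideanSpace ℝ (Fin d))}
    {x : EuclideanSpace ℝ (Fin d)} (hx : x ∈ K) :
    cornerCube (gridCorner r (gridIndex r x)) r ⊆ cthickening (d * r) K :=
  fun y hy => mem_cthickening_of_dist_le y x _ K hx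
    (dist_le_of_mem_cornerCube hr.le hy (mem_cornerCube_gridIndex hr x))

lemma card_mul_pow_le_volume_cthickening (hr : 0 < r) {K : Set (EuclideanSpace ℝ (Fin d))}
    {F : Finset (Fin d → ℤ)} (hF : ↑F ⊆ gridIndex r '' K) :
    ENNReal.ofReal (F.card * r ^ d) ≤ volume (cthickening (d * r) K) := by
  calc ENNReal.ofReal (F.card * r ^ d)
      = ∑ k ∈ F, volume {x : EuclideanSpace ℝ (Fin d) | gridIndex r x = k} := by
        simp only [volume_gridCell hr, Finset.sum_const, nsmul_eq_mul]
        rw [ENNReal.ofReal_mul (by positivity), ENNReal.ofReal_natCast]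
    _ = volume (⋃ k ∈ F, {x : EuclideanSpace ℝ (Fin d) | gridIndex r x = k}) := by
        rw [measure_biUnion_finset _ fun k _ => measurableSet_gridCell hr k]
        intro k _ l _ hkl
        exact Set.disjoint_left.2 fun x hx hx' => hkl (hx.symm.trans hx')
    _ ≤ _ := by
        refine measure_mono (iUnion₂_subset fun k hk y hy => ?_)
        obtain ⟨x, hx, rfl⟩ := hF hk
        refine cornerCube_gridIndex_subset_cthickening hr hx ?_
        have := mem_cornerCube_gridIndex hr y
        rwa [show gridIndex r y = gridIndex r x from hy] at this

lemma volume_le_card_mul_pow (hr : 0 < r) {K : Set (EuclideanSpace ℝ (Fin d))}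
    {F : Finset (Fin d → ℤ)} (hF : gridIndex r '' K ⊆ ↑F) :
    volume K ≤ ENNReal.ofReal (F.card * r ^ d) := by
  calc volume K ≤ volume (⋃ k ∈ F, {x : EuclideanSpace ℝ (Fin d) | gridIndex r x = k}) :=
        measure_mono fun x hx => mem_iUnion₂.2 ⟨gridIndex r x, hF ⟨x, hx, rfl⟩, rfl⟩
    _ ≤ ∑ k ∈ F, volume {x : EuclideanSpace ℝ (Fin d) | gridIndex r x = k} :=
        measure_biUnion_finset_le _ _
    _ = ENNReal.ofReal (F.card * r ^ d) := by
        simp only [volume_gridCell hr, Finset.sum_const, nsmul_eq_mul]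
        rw [ENNReal.ofReal_mul (by positivity), ENNReal.ofReal_natCast]

end Grid

section Bounds

variable {d : ℕ} {s g : ℝ} {A : Set (EuclideanSpace ℝ (Fin d))}

lemma le_liminf_minRieszEnergy (hd : 1 ≤ d) (hs : 0 ≤ s) (hg : 0 < g)
    (hlim : Tendsto
      (fun N : ℕ => minRieszEnergy s (unitCube d) N / ENNReal.ofReal (tauNorm s d N)) atTop
      (𝓝 (ENNReal.ofReal g))) (hA : Bornology.IsBounded A) (hne : A.Nonempty) :
    ENNReal.ofReal g * volume (closure A) ^ (-(s / (d : ℝ))) ≤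
      liminf (fun N : ℕ => minRieszEnergy s A N / ENNReal.ofReal (tauNorm s d N)) atTop := by
  have hK : IsCompact (closure A) := hA.isCompact_closure
  have hscale : Tendsto (fun r : ℝ => (d : ℝ) * r) (𝓝[>] 0) (𝓝 0) := by
    have : Continuous fun r : ℝ => (d : ℝ) * r := by fun_prop
    simpa using (this.tendsto 0).mono_left nhdsWithin_le_nhds
  have hvol := (tendsto_measure_cthickening_of_isCompact (μ := volume) hK).comp hscale
  refine le_of_tendsto (ENNReal.Tendsto.const_mul
    ((ENNReal.continuous_rpow_const (y := -(s / (d : ℝ)))).tendsto _ |>.comp hvol)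
    (Or.inr ENNReal.ofReal_ne_top)) ?_
  filter_upwards [self_mem_nhdsWithin] with r (hr : 0 < r)
  have hfin := finite_gridIndex_image hr hK.isBounded
  have hF : hfin.toFinset.Nonempty := by simpa using hne.closure
  refine le_trans ?_ (le_liminf_of_subset_iUnion_cornerCube hd hs hg hlim hF hr
    (a := gridCorner r) fun x hx => ⟨gridIndex r x, ?_, mem_cornerCube_gridIndex hr x⟩)
  · exact mul_le_mul' le_rfl <| ENNReal.rpow_neg_anti (by positivity)
      (card_mul_pow_le_volume_cthickening hr hfin.coe_toFinset.subset)
  · exact hfin.mem_toFinset.2 ⟨x, subset_closure hx, rfl⟩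

lemma limsup_minRieszEnergy_le (hd : 1 ≤ d) (hs : (d : ℝ) ≤ s) (hg : 0 < g)
    (hlim : Tendsto
      (fun N : ℕ => minRieszEnergy s (unitCube d) N / ENNReal.ofReal (tauNorm s d N)) atTop
      (𝓝 (ENNReal.ofReal g))) (hA : Bornology.IsBounded A) :
    limsup (fun N : ℕ => minRieszEnergy s A N / ENNReal.ofReal (tauNorm s d N)) atTop ≤
      ENNReal.ofReal g * volume (interior A) ^ (-(s / (d : ℝ))) := by
  have hs0 : 0 < s := lt_of_lt_of_le (by positivity) hs
  have hsd : 0 < s / d := by positivity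
  rcases eq_or_ne (volume (interior A)) 0 with h0 | h0
  · rw [h0, ENNReal.zero_rpow_of_neg (by linarith), ENNReal.mul_top (by simpa using hg)]
    exact le_top
  have htop : volume (interior A) ≠ ∞ := (hA.subset interior_subset).measure_lt_top.ne
  have hcont : Tendsto (fun θ : ℝ => ENNReal.ofReal g *
      (ENNReal.ofReal (θ ^ d) * (ENNReal.ofReal θ * volume (interior A))) ^ (-(s / (d : ℝ))))
      (𝓝[<] 1) (𝓝 (ENNReal.ofReal g * volume (interior A) ^ (-(s / (d : ℝ))))) := by
    refine ENNReal.Tendsto.const_mul ((ENNReal.continuous_rpow_const).tendsto _ |>.comp ?_)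
      (Or.inr ENNReal.ofReal_ne_top)
    have h₁ : Tendsto (fun θ : ℝ => ENNReal.ofReal (θ ^ d)) (𝓝[<] 1) (𝓝 1) := by
      have : Continuous fun θ : ℝ => ENNReal.ofReal (θ ^ d) :=
        ENNReal.continuous_ofReal.comp (continuous_pow d)
      simpa using (this.tendsto 1).mono_left nhdsWithin_le_nhds
    have h₂ : Tendsto (fun θ : ℝ => ENNReal.ofReal θ) (𝓝[<] 1) (𝓝 1) := by
      simpa using (ENNReal.continuous_ofReal.tendsto 1).mono_left nhdsWithin_le_nhds
    simpa using ENNReal.Tendsto.mul h₁ (Or.inl one_ne_zero)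
      (ENNReal.Tendsto.mul_const h₂ (Or.inr htop)) (Or.inr ENNReal.one_ne_top)
  refine ge_of_tendsto hcont ?_
  filter_upwards [Ioo_mem_nhdsLT (zero_lt_one' ℝ)] with θ ⟨hθ0, hθ1⟩
  have hlt : ENNReal.ofReal θ * volume (interior A) < volume (interior A) := by
    conv_rhs => rw [← one_mul (volume (interior A))]
    exact ENNReal.mul_lt_mul_left h0 htop (by simpa using hθ1)
  obtain ⟨K, hKA, hK, hKvol⟩ := isOpen_interior.exists_lt_isCompact hlt
  obtain ⟨ε, hε, hεA⟩ := hK.exists_cthickening_subset_open isOpen_interior hKA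
  have hd0 : (0 : ℝ) < d := by positivity
  set r : ℝ := ε / d with hr_def
  have hr : 0 < r := by positivity
  have hdr : d * r = ε := mul_div_cancel₀ _ hd0.ne'
  have hfin := finite_gridIndex_image hr hK.isBounded
  have hKne : K.Nonempty := nonempty_of_measure_ne_zero (zero_le.trans_lt hKvol).ne'
  have hF : hfin.toFinset.Nonempty := by simpa using hKne
  refine (limsup_le_of_separated_cubes hd hs hg hlim hF (t := θ * r) (δ := r - θ * r)
    (a := gridCorner r) (by positivity) (by nlinarith) ?_ ?_).trans ?_
  · intro k hk
    obtain ⟨x, hx, rfl⟩ := hfin.mem_toFinset.1 hk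
    exact (cornerCube_mono _ (by nlinarith)).trans
      ((cornerCube_gridIndex_subset_cthickening hr hx).trans
        (hdr ▸ hεA.trans interior_subset))
  · intro k _ l _ hkl x hx y hy
    exact sub_le_dist_of_mem_cornerCube_gridCorner hr.le hkl hx hy
  · refine mul_le_mul' le_rfl (ENNReal.rpow_neg_anti hsd.le ?_)
    rw [show (hfin.toFinset.card : ℝ) * (θ * r) ^ d = θ ^ d * (hfin.toFinset.card * r ^ d) by ring,
      ENNReal.ofReal_mul (by positivity)]
    gcongr
    exact hKvol.le.trans (volume_le_card_mul_pow hr hfin.coe_toFinset.superset)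

end Bounds

/-- for `s ≥ d` and a bounded almost clopen set `A ⊆ ℝ^d` (i.e. `H_d(∂A) = 0`),
`ℰ_s(A,N)/τ_{s,d}(N) → g_{s,d}(U^d) · H_d(A)^{-s/d}` in `[0,∞]`, where `g_{s,d}(U^d)` is the
(positive finite) limit for the unit cube. -/
theorem tendsto_minRieszEnergy_almostClopen (d : ℕ) (hd : 1 ≤ d) (s : ℝ) (hs : (d : ℝ) ≤ s)
    (A : Set (EuclideanSpace ℝ (Fin d))) (hA : Bornology.IsBounded A)
    (hclopen : volume (frontier A) = 0)
    (gU : ℝ) (hgU : 0 < gU)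
    (hgUlim : Tendsto
      (fun N : ℕ => minRieszEnergy s (unitCube d) N / ENNReal.ofReal (tauNorm s d N)) atTop
      (𝓝 (ENNReal.ofReal gU))) :
    Tendsto
      (fun N : ℕ => minRieszEnergy s A N / ENNReal.ofReal (tauNorm s d N)) atTop
      (𝓝 (ENNReal.ofReal gU * (volume A) ^ (-(s / (d : ℝ))))) := by
  have hs0 : 0 < s := lt_of_lt_of_le (by positivity) hs
  rcases A.eq_empty_or_nonempty with rfl | hne
  · have hsd : 0 < s / d := by positivity
    rw [measure_empty, ENNReal.zero_rpow_of_neg (by linarith), ENNReal.mul_top (by simpa using hgU)]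
    refine tendsto_const_nhds.congr' ?_
    filter_upwards [eventually_ge_atTop 1] with N hN
    have : minRieszEnergy s (∅ : Set (EuclideanSpace ℝ (Fin d))) N = ∞ := by
      refine top_le_iff.1 (le_minRieszEnergy fun ω hω hcard => ?_)
      rw [subset_empty_iff, Finset.coe_eq_empty] at hω
      rw [hω, Finset.card_empty] at hcard
      omega
    rw [this, ENNReal.top_div_of_ne_top ENNReal.ofReal_ne_top]
  · have hcl : volume (closure A) = volume A := by
      refine le_antisymm ?_ (measure_mono subset_closure)
      rw [closure_eq_self_union_frontier]
      simpa [hclopen] using measure_union_le (μ := volume) A (frontier A)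
    have hint : volume (interior A) = volume A := by
      rw [← self_sdiff_frontier]
      exact measure_sdiff_null hclopen
    refine tendsto_of_le_liminf_of_limsup_le ?_ ?_
    · exact hcl ▸ le_liminf_minRieszEnergy hd hs0.le hgU hgUlim hA hne
    · exact hint ▸ limsup_minRieszEnergy_le hd hs hgU hgUlim hA
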